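/- arXiv:2503.01707 — 4 statements merged into one kernel-verified Lean document; each statement's English description precedes it below -/
import Mathlib

section
/- Let d ≥ 2, let g ∈ ℝ^d be nonzero, set e := -g/‖g‖ and δ(t) := t‖g‖/(d-1). Let u₀ ∈ ℝ^d be a unit vector and define u(t) := (u₀ + (sinh δ(t) + ⟨e,u₀⟩(cosh δ(t) - 1)) e) / (cosh δ(t) + ⟨e,u₀⟩ sinh δ(t)). Then u(0) = u₀ and u is differentiable with u'(t) = -(1/(d-1))·(g - ⟨u(t), g⟩ u(t)) for all t; that is, the explicit update formula solves the microcanonical velocity equation with frozen gradient g = ∇L(x). -/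
open scoped RealInnerProductSpace

/-- The denominator of the update formula is positive. -/
theorem cosh_add_mul_sinh_pos {a : ℝ} (ha : |a| ≤ 1) (x : ℝ) :
    0 < Real.cosh x + a * Real.sinh x := by
  obtain ⟨h₁, h₂⟩ := abs_le.mp ha
  rw [Real.cosh_eq, Real.sinh_eq]
  have hp := Real.exp_pos x
  have hn := Real.exp_pos (-x)
  rcases le_total 0 a with h | h
  · nlinarith [mul_nonneg h hp.le, mul_nonneg (sub_nonneg.mpr h₂) hn.le]
  · nlinarith [mul_nonneg (neg_nonneg.mpr h) hn.le,
      mul_nonneg (neg_le_iff_add_nonneg.mp h₁) hp.le]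

/-- The curve `x ↦ (u₀ + (sinh x + ⟪e, u₀⟫ (cosh x - 1)) e) / (cosh x + ⟪e, u₀⟫ sinh x)`, with `e`
a unit vector, has velocity equal to the component of `e` orthogonal to the curve. -/
theorem hasDerivAt_microcanonical_curve {E : Type*} [NormedAddCommGroup E] [InnerProductSpace ℝ E]
    {e u₀ : E} (he : ‖e‖ = 1) {w : ℝ → E}
    (hw : ∀ x, w x = (Real.cosh x + ⟪e, u₀⟫ * Real.sinh x)⁻¹ •
      (u₀ + (Real.sinh x + ⟪e, u₀⟫ * (Real.cosh x - 1)) • e))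
    {x : ℝ} (hx : Real.cosh x + ⟪e, u₀⟫ * Real.sinh x ≠ 0) :
    HasDerivAt w (e - ⟪w x, e⟫ • w x) x := by
  have hD := ((Real.hasDerivAt_cosh x).fun_add ((Real.hasDerivAt_sinh x).const_mul ⟪e, u₀⟫)).fun_inv hx
  have hN := (((Real.hasDerivAt_sinh x).fun_add
    (((Real.hasDerivAt_cosh x).sub_const 1).const_mul ⟪e, u₀⟫)).smul_const e).const_add u₀
  have hinner : ⟪w x, e⟫ = (Real.cosh x + ⟪e, u₀⟫ * Real.sinh x)⁻¹ *
      (Real.sinh x + ⟪e, u₀⟫ * Real.cosh x) := by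
    rw [hw, real_inner_smul_left, inner_add_left, real_inner_smul_left,
      real_inner_self_eq_norm_sq, he, real_inner_comm]
    ring
  rw [hinner, hw x, funext hw]
  convert hD.fun_smul hN using 1
  match_scalars <;> field_simp
  ring

/-- The explicit microcanonical velocity update formula solves the microcanonical
velocity equation `u̇ = -(I - u uᵀ) g / (d-1)` with frozen gradient `g`. -/
theorem microcanonical_update_solves_ode {d : ℕ} (hd : 2 ≤ d)
    (g : EuclideanSpace ℝ (Fin d)) (hg : g ≠ 0)
    (e : EuclideanSpace ℝ (Fin d)) (he : e = -(‖g‖⁻¹ • g))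
    (δ : ℝ → ℝ) (hδ : ∀ t, δ t = t * ‖g‖ / ((d : ℝ) - 1))
    (u₀ : EuclideanSpace ℝ (Fin d)) (hu₀ : ‖u₀‖ = 1)
    (u : ℝ → EuclideanSpace ℝ (Fin d))
    (hu : ∀ t, u t = (Real.cosh (δ t) + ⟪e, u₀⟫ * Real.sinh (δ t))⁻¹ •
      (u₀ + (Real.sinh (δ t) + ⟪e, u₀⟫ * (Real.cosh (δ t) - 1)) • e)) :
    u 0 = u₀ ∧
    ∀ t, HasDerivAt u (-(((d : ℝ) - 1)⁻¹) • (g - ⟪u t, g⟫ • u t)) t := by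
  have hgn : ‖g‖ ≠ 0 := norm_ne_zero_iff.mpr hg
  have he₁ : ‖e‖ = 1 := by
    rw [he, norm_neg, norm_smul, norm_inv, norm_norm, inv_mul_cancel₀ hgn]
  have hge : g = -(‖g‖ • e) := by
    rw [he, smul_neg, neg_neg, smul_inv_smul₀ hgn]
  have ha : |⟪e, u₀⟫| ≤ 1 := by
    simpa [he₁, hu₀] using abs_real_inner_le_norm e u₀
  refine ⟨by simp [hu, hδ], fun t => ?_⟩
  have hδ' : HasDerivAt δ (‖g‖ / ((d : ℝ) - 1)) t := by
    rw [funext hδ]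
    simpa using ((hasDerivAt_id t).mul_const ‖g‖).div_const ((d : ℝ) - 1)
  have h := (hasDerivAt_microcanonical_curve he₁ (u₀ := u₀) (fun _ => rfl)
    (cosh_add_mul_sinh_pos ha (δ t)).ne').scomp t hδ'
  rw [← hu t] at h
  have hi : ⟪u t, g⟫ = -(‖g‖ * ⟪u t, e⟫) := by
    conv_lhs => rw [hge]
    rw [inner_neg_right, real_inner_smul_right]
  refine (h.congr_of_eventuallyEq (.of_forall hu)).congr_deriv ?_
  rw [hi]
  nth_rewrite 2 [hge]
  module
end

section
/- Let e, u ∈ ℝ^d be unit vectors and δ ∈ ℝ, and let B_δ denote the microcanonical velocity update associated with e and δ. Then B_δ(-B_δ(u)) = -u. That is, the composition of the update, the velocity flip u ↦ -u, the update again, and a final velocity flip is the identity, so the time-reversed leapfrog step undoes the forward step. -/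
open scoped RealInnerProductSpace

/-- The microcanonical velocity update associated with the unit vector `e` and
step `δ`: `B_δ(u) = (u + (sinh δ + ⟨e,u⟩(cosh δ - 1)) e) / (cosh δ + ⟨e,u⟩ sinh δ)`. -/
noncomputable def microUpdate {d : ℕ} (e : EuclideanSpace ℝ (Fin d)) (δ : ℝ)
    (u : EuclideanSpace ℝ (Fin d)) : EuclideanSpace ℝ (Fin d) :=
  (Real.cosh δ + ⟪e, u⟫ * Real.sinh δ)⁻¹ •
    (u + (Real.sinh δ + ⟪e, u⟫ * (Real.cosh δ - 1)) • e)

/-- The denominator of the microcanonical update is positive. -/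
theorem cosh_add_mul_sinh_pos_s5 {c : ℝ} (hc : |c| ≤ 1) (δ : ℝ) :
    0 < Real.cosh δ + c * Real.sinh δ := by
  obtain ⟨h₁, h₂⟩ := abs_le.mp hc
  rw [Real.cosh_eq, Real.sinh_eq]
  nlinarith [Real.exp_pos δ, Real.exp_pos (-δ),
    mul_nonneg (sub_nonneg.mpr h₂) (Real.exp_pos (-δ)).le,
    mul_nonneg (neg_le_iff_add_nonneg.mp h₁) (Real.exp_pos δ).le]

/-- The component of the updated velocity along `e`. -/
theorem inner_microUpdate {d : ℕ} {e : EuclideanSpace ℝ (Fin d)} (he : ‖e‖ = 1) (δ : ℝ)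
    (u : EuclideanSpace ℝ (Fin d)) :
    ⟪e, microUpdate e δ u⟫ =
      (Real.cosh δ + ⟪e, u⟫ * Real.sinh δ)⁻¹ * (Real.sinh δ + ⟪e, u⟫ * Real.cosh δ) := by
  rw [microUpdate, inner_smul_right, inner_add_right, inner_smul_right,
    real_inner_self_eq_norm_sq, he]
  ring

/-- Reversibility of the microcanonical velocity update: `B_δ(-B_δ(u)) = -u`,
i.e. update, flip, update, flip is the identity. -/
theorem microcanonical_update_reversible {d : ℕ}
    (e u : EuclideanSpace ℝ (Fin d)) (he : ‖e‖ = 1) (hu : ‖u‖ = 1) (δ : ℝ) :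
    microUpdate e δ (-(microUpdate e δ u)) = -u := by
  have hc : |⟪e, u⟫| ≤ 1 := by
    simpa [he, hu] using abs_real_inner_le_norm e u
  have hD := (cosh_add_mul_sinh_pos_s5 hc δ).ne'
  have hcs := Real.cosh_sq δ
  have hD' : Real.cosh δ + ⟪e, -microUpdate e δ u⟫ * Real.sinh δ =
      (Real.cosh δ + ⟪e, u⟫ * Real.sinh δ)⁻¹ := by
    rw [inner_neg_right, inner_microUpdate he]
    field_simp
    linear_combination hcs
  rw [microUpdate, hD', inv_inv, inner_neg_right, inner_microUpdate he, microUpdate]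
  match_scalars
  · field_simp
  · field_simp
    linear_combination (-⟪e, u⟫) * hcs
end

section
/- Let g ∈ ℝ^d and let y : ℝ → ℝ^d be twice differentiable with ⟨g, y(t)⟩ ≠ 0 for all t and satisfying the linear second-order equation y''(t) = ⟨g, y(t)⟩ • g. Then u(t) := y'(t)/⟨g, y(t)⟩ satisfies the vector Riccati equation u'(t) = g - ⟨g, u(t)⟩ u(t), i.e., u'(t) = (I - u(t)u(t)ᵀ)g. -/
open scoped RealInnerProductSpace

/-- The substitution `u = y' / ⟨g, y⟩` turns the linear second-order equation
`y'' = ⟨g, y⟩ g = (g gᵀ) y` into the vector Riccati equation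
`u' = g - ⟨g, u⟩ u = (I - u uᵀ) g`. -/
theorem riccati_linearization {d : ℕ} (g : EuclideanSpace ℝ (Fin d))
    (y y' : ℝ → EuclideanSpace ℝ (Fin d))
    (hy : ∀ t, HasDerivAt y (y' t) t)
    (hy' : ∀ t, HasDerivAt y' (⟪g, y t⟫ • g) t)
    (hne : ∀ t, ⟪g, y t⟫ ≠ 0)
    (u : ℝ → EuclideanSpace ℝ (Fin d))
    (hu : ∀ t, u t = (⟪g, y t⟫)⁻¹ • y' t) :
    ∀ t, HasDerivAt u (g - ⟪g, u t⟫ • u t) t := by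
  intro t
  have hs : HasDerivAt (fun s => ⟪g, y s⟫) ⟪g, y' t⟫ t := by
    simpa using (hasDerivAt_const t g).inner ℝ (hy t)
  rw [funext hu]
  refine ((hs.inv (hne t)).smul (hy' t)).congr_deriv ?_
  simp only [Pi.inv_apply]
  rw [smul_smul, inv_mul_cancel₀ (hne t), one_smul, real_inner_smul_right, smul_smul,
    sub_eq_add_neg, ← neg_smul]
  congr 2
  field_simp
end

section
/- Fix δ ∈ ℝ and for θ ∈ (0, π) define θ'(θ) := arccos( (sinh δ + cos θ · cosh δ) / (cosh δ + cos θ · sinh δ) ). Then for every θ ∈ (0, π) the function θ' is differentiable at θ with derivative dθ'/dθ = 1/(cosh δ + cos θ · sinh δ). In particular the Jacobian of the angular coordinate of the microcanonical velocity update is 1/(cosh δ + cos θ sinh δ). -/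
theorem Real.cosh_add_cos_mul_sinh_pos (δ θ : ℝ) :
    0 < Real.cosh δ + Real.cos θ * Real.sinh δ := by
  have h : |Real.cos θ * Real.sinh δ| < Real.cosh δ := by
    rw [abs_mul]
    calc |Real.cos θ| * |Real.sinh δ| ≤ 1 * |Real.sinh δ| := by
          gcongr
          exact Real.abs_cos_le_one θ
      _ < Real.cosh δ := by
          rw [one_mul]
          refine abs_lt_of_sq_lt_sq ?_ (Real.cosh_pos δ).le
          linarith [Real.cosh_sq δ]
  linarith [(abs_lt.mp h).1]

/-- Jacobian of the angular coordinate of the microcanonical velocity update: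
for `θ ∈ (0, π)`, the map
`θ ↦ arccos((sinh δ + cos θ cosh δ)/(cosh δ + cos θ sinh δ))`
is differentiable with derivative `1/(cosh δ + cos θ sinh δ)`. -/
theorem angular_update_jacobian (δ : ℝ) (θ' : ℝ → ℝ)
    (hθ' : ∀ θ, θ' θ = Real.arccos ((Real.sinh δ + Real.cos θ * Real.cosh δ) /
      (Real.cosh δ + Real.cos θ * Real.sinh δ))) :
    ∀ θ ∈ Set.Ioo (0 : ℝ) Real.pi,
      HasDerivAt θ' (1 / (Real.cosh δ + Real.cos θ * Real.sinh δ)) θ := by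
  intro θ hθ
  obtain rfl : θ' = _ := funext hθ'
  have hD := Real.cosh_add_cos_mul_sinh_pos δ θ
  have hs : 0 < Real.sin θ := Real.sin_pos_of_mem_Ioo hθ
  have hquot : HasDerivAt (fun t => (Real.sinh δ + Real.cos t * Real.cosh δ) /
      (Real.cosh δ + Real.cos t * Real.sinh δ))
      (-Real.sin θ / (Real.cosh δ + Real.cos θ * Real.sinh δ) ^ 2) θ := by
    refine ((((Real.hasDerivAt_cos θ).mul_const (Real.cosh δ)).const_add (Real.sinh δ)).fun_div
      (((Real.hasDerivAt_cos θ).mul_const (Real.sinh δ)).const_add (Real.cosh δ)) hD.ne').congr_deriv ?_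
    congr 1
    linear_combination -Real.sin θ * Real.cosh_sq δ
  have hsq : 1 - ((Real.sinh δ + Real.cos θ * Real.cosh δ) /
      (Real.cosh δ + Real.cos θ * Real.sinh δ)) ^ 2 =
      (Real.sin θ / (Real.cosh δ + Real.cos θ * Real.sinh δ)) ^ 2 := by
    rw [div_pow, div_pow, eq_div_iff (by positivity), sub_mul, div_mul_cancel₀ _ (by positivity)]
    linear_combination (1 - Real.cos θ ^ 2) * Real.cosh_sq δ - Real.sin_sq_add_cos_sq θ
  have hpos : 0 < Real.sin θ / (Real.cosh δ + Real.cos θ * Real.sinh δ) := div_pos hs hD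
  have hpos_sq := pow_pos hpos 2
  rw [← hsq] at hpos_sq
  refine ((Real.hasDerivAt_arccos (fun h => ?_) (fun h => ?_)).comp θ hquot).congr_deriv ?_
  · norm_num [h] at hpos_sq
  · norm_num [h] at hpos_sq
  · rw [hsq, Real.sqrt_sq hpos.le]
    field_simp
end
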